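/- With the lattice models of the context: for every strictly decreasing tuple μ = (μ₁ > μ₂ > … > μ_r ≥ 0) of integers with μ₁ < Nm and every σ ∈ {1,…,m}^r, Z^{(R,…,R),N}_{μ,σ}(z₁,…,z_r) = (z₁z₂⋯z_r)^N · Z^{(L,…,L),N}_{μ,(σ_r,…,σ₁)}(z_r,…,z₁), i.e. the partition function of the all-right-moving system equals (z₁⋯z_r)^N times the partition function of the all-left-moving system with the horizontal boundary colors reversed and with row t carrying row parameter z_{r+1−t}. -/

import Mathlib

namespace Lattice

/-- Row types: left-moving (`L`) and right-moving (`R`). -/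
inductive RowType | L | R
deriving DecidableEq

/-- An index for the independent indeterminates `X_{i,j}` with `1 ≤ i < j ≤ m`. -/
structure XIdx (m : ℕ) where
  i : ℕ
  j : ℕ
  hi : 1 ≤ i
  hij : i < j
  hj : j ≤ m

/-- The indeterminates `q`, `Φ`, `z₁, …, z_r` and `X_{i,j}` for `1 ≤ i < j ≤ m`. -/
abbrev Vars (m r : ℕ) := Unit ⊕ Unit ⊕ Fin r ⊕ XIdx m

/-- The field of rational functions over `ℚ` in the indeterminates `Vars m r`. -/
abbrev K (m r : ℕ) := FractionRing (MvPolynomial (Vars m r) ℚ)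

noncomputable def vr (m r : ℕ) (v : Vars m r) : K m r :=
  algebraMap (MvPolynomial (Vars m r) ℚ) (K m r) (MvPolynomial.X v)

/-- The indeterminate `q`. -/
noncomputable def qv (m r : ℕ) : K m r := vr m r (Sum.inl ())

/-- The indeterminate `Φ`. -/
noncomputable def Φv (m r : ℕ) : K m r := vr m r (Sum.inr (Sum.inl ()))

/-- The indeterminate `z_t` (`0`-based: `zv m r t` is the row parameter of row `t+1`). -/
noncomputable def zv (m r : ℕ) (t : Fin r) : K m r := vr m r (Sum.inr (Sum.inr (Sum.inl t)))

/-- The indeterminate `X_{i,j}` for `1 ≤ i < j ≤ m`. -/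
noncomputable def Xv (m r : ℕ) (idx : XIdx m) : K m r := vr m r (Sum.inr (Sum.inr (Sum.inr idx)))

/-- `𝔛_{i,j}`: equal to `X_{i,j}` for `i < j`, to `q²X_{j,i}⁻¹` for `i > j`, and to `−q²`
for `i = j` (colors in range `1 ≤ i, j ≤ m`). -/
noncomputable def Xfrak (m r : ℕ) (i j : ℕ) : K m r :=
  if h : 1 ≤ i ∧ i < j ∧ j ≤ m then Xv m r ⟨i, j, h.1, h.2.1, h.2.2⟩
  else if h' : 1 ≤ j ∧ j < i ∧ i ≤ m then
    (qv m r) ^ 2 * (Xv m r ⟨j, i, h'.1, h'.2.1, h'.2.2⟩)⁻¹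
  else -(qv m r) ^ 2

/-- The vertex weight of the configuration `(left, top, right, bottom) = (a,b,c,d)` for a
vertex of row type `ty` with row parameter `z` in a column of column color `c_j`. -/
noncomputable def wtVertex (m r : ℕ) (ty : RowType) (z : K m r) (j : ℕ) (a b c d : ℕ) :
    K m r :=
  match ty with
  | .R =>
      if a = 0 ∧ b = 0 ∧ c = 0 ∧ d = 0 then 1
      else if a ≠ 0 ∧ b = j ∧ c = a ∧ d = j then
        Φv m r * Xfrak m r a j * (if a = j then z else 1)
      else if a = 0 ∧ b = j ∧ c = 0 ∧ d = j then Φv m r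
      else if a ≠ 0 ∧ b = 0 ∧ c = a ∧ d = 0 then (if a = j then z else 1)
      else if a = j ∧ b = 0 ∧ c = 0 ∧ d = j then Φv m r * (1 - (qv m r) ^ 2) * z
      else if a = 0 ∧ b = j ∧ c = j ∧ d = 0 then 1
      else 0
  | .L =>
      if a = 0 ∧ b = 0 ∧ c = 0 ∧ d = 0 then 1
      else if a ≠ 0 ∧ b = j ∧ c = a ∧ d = j then
        Φv m r * Xfrak m r j a * (if a = j then z⁻¹ else 1)
      else if a = 0 ∧ b = j ∧ c = 0 ∧ d = j then Φv m r
      else if a ≠ 0 ∧ b = 0 ∧ c = a ∧ d = 0 then (if a = j then z⁻¹ else 1)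
      else if a = 0 ∧ b = 0 ∧ c = j ∧ d = j then Φv m r * (1 - (qv m r) ^ 2)
      else if a = j ∧ b = j ∧ c = 0 ∧ d = 0 then z⁻¹
      else 0

/-- A state: spins on horizontal and vertical edges of the grid with `r` rows and `Nc`
columns. -/
abbrev St (m r Nc : ℕ) :=
  (Fin r → Fin (Nc + 1) → Fin (m + 1)) × (Fin (r + 1) → Fin Nc → Fin (m + 1))

/-- The column number of the column at position `p` from the left
(columns are numbered `Nc−1, …, 1, 0` from left to right). -/
def colNum (Nc : ℕ) (p : Fin Nc) : ℕ := Nc - 1 - (p : ℕ)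

/-- The column color of the column at position `p`: the column numbered `x` has column
color `c_{m − (x mod m)}`. -/
def colColor (m Nc : ℕ) (p : Fin Nc) : ℕ := m - colNum Nc p % m

/-- The Boltzmann weight of a state, with row types `Θ` and row parameters `w`. -/
noncomputable def wtState (m r Nc : ℕ) (Θ : Fin r → RowType) (w : Fin r → K m r)
    (s : St m r Nc) : K m r :=
  ∏ t : Fin r, ∏ p : Fin Nc,
    wtVertex m r (Θ t) (w t) (colColor m Nc p)
      (s.1 t p.castSucc : ℕ) (s.2 t.castSucc p : ℕ) (s.1 t p.succ : ℕ) (s.2 t.succ p : ℕ)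

/-- The boundary conditions of the system `𝔖^{Θ,N}_{μ,σ}`. -/
def bc (m r Nc : ℕ) (Θ : Fin r → RowType) (μ σ : Fin r → ℕ) (s : St m r Nc) : Prop :=
  (∀ p : Fin Nc,
      (s.2 0 p : ℕ) = if ∃ t : Fin r, μ t = colNum Nc p then colColor m Nc p else 0) ∧
  (∀ p : Fin Nc, s.2 (Fin.last r) p = 0) ∧
  (∀ t : Fin r,
    (Θ t = RowType.R → (s.1 t 0 : ℕ) = 0 ∧ (s.1 t (Fin.last Nc) : ℕ) = σ t) ∧
    (Θ t = RowType.L → (s.1 t (Fin.last Nc) : ℕ) = 0 ∧ (s.1 t 0 : ℕ) = σ t))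

/-- The partition function `Z^{Θ,N}_{μ,σ}(w₁,…,w_r)`: the sum of the weights of all states
satisfying the boundary conditions. -/
noncomputable def Z (m r Nc : ℕ) (Θ : Fin r → RowType) (w : Fin r → K m r)
    (μ σ : Fin r → ℕ) : K m r :=
  ∑ s : St m r Nc,
    @ite _ (bc m r Nc Θ μ σ s) (Classical.propDecidable _) (wtState m r Nc Θ w s) 0

section Crossing

variable {F : Type*} [Field F]

/-- The weights of the crossing on pairs of equal spins, when the next column to its right has
color `s`. -/
def pairWeight (m : ℕ) (Q Φ u : F) (s a c : ℕ) : F :=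
  if a = 0 then
    if c = 0 then Φ * (1 - Q ^ (m + 1) * u)
    else (1 - Q) * Q ^ (if c < s then s - 1 - c else m + s - 1 - c)
  else if c = 0 then (1 - Q) * u * Q ^ (if a < s then m + a - s else a - s)
  else if a = c then (Q ^ (m - 1) * u - 1) / Φ
  else (1 - Q) / Φ * Q ^ (if a < c then m - 1 - (c - a) else a - c - 1) *
    (if (a < c ∧ ¬(a < s ∧ s ≤ c)) ∨ (c < s ∧ s ≤ a) then u else 1)

theorem pairWeight_wrap {m : ℕ} (Q Φ u : F) {a c : ℕ} (ha : a ≤ m) (hc : c ≤ m) :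
    pairWeight m Q Φ u (m + 1) a c = pairWeight m Q Φ u 1 a c := by
  rcases eq_or_ne a 0 with rfl | ha0 <;> rcases eq_or_ne c 0 with rfl | hc0
  · simp [pairWeight]
  · have h : (if c < m + 1 then m + 1 - 1 - c else m + (m + 1) - 1 - c) =
      if c < 1 then 1 - 1 - c else m + 1 - 1 - c := by split_ifs <;> omega
    simp only [pairWeight, hc0, h, if_true, if_false]
  · have h : (if a < m + 1 then m + a - (m + 1) else a - (m + 1)) =
      if a < 1 then m + a - 1 else a - 1 := by split_ifs <;> omega
    simp only [pairWeight, ha0, h, if_true, if_false]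
  · have h : ((a < c ∧ ¬(a < m + 1 ∧ m + 1 ≤ c)) ∨ (c < m + 1 ∧ m + 1 ≤ a)) =
      ((a < c ∧ ¬(a < 1 ∧ 1 ≤ c)) ∨ (c < 1 ∧ 1 ≤ a)) := propext (by omega)
    simp only [pairWeight, ha0, hc0, h, if_false]

theorem pairWeight_zero_left {m s c : ℕ} (Q : F) {Φ : F} (u : F) (hΦ : Φ ≠ 0) (hs : s ≠ 0)
    (hc : c ≠ 0) (hcs : c ≠ s) :
    pairWeight m Q Φ u s 0 c = Φ * pairWeight m Q Φ u (s + 1) s c := by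
  have h : (if c < s then s - 1 - c else m + s - 1 - c) =
    if s < c then m - 1 - (c - s) else s - c - 1 := by split_ifs <;> omega
  have h' : ¬((s < c ∧ ¬(s < s + 1 ∧ s + 1 ≤ c)) ∨ (c < s + 1 ∧ s + 1 ≤ s)) := by omega
  simp only [pairWeight, hc, hs, hcs.symm, h, h', if_true, if_false]
  field_simp

theorem pairWeight_succ_zero_left {m s c : ℕ} (Q : F) {Φ : F} (u : F) (hΦ : Φ ≠ 0) (hs : s ≠ 0)
    (hc : c ≠ 0) (hcs : c ≠ s) (hcm : c ≤ m) :
    pairWeight m Q Φ u (s + 1) 0 c = Φ * Q * pairWeight m Q Φ u (s + 1) s c := by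
  have h : (if c < s + 1 then s + 1 - 1 - c else m + (s + 1) - 1 - c) =
    (if s < c then m - 1 - (c - s) else s - c - 1) + 1 := by split_ifs <;> omega
  have h' : ¬((s < c ∧ ¬(s < s + 1 ∧ s + 1 ≤ c)) ∨ (c < s + 1 ∧ s + 1 ≤ s)) := by omega
  simp only [pairWeight, hc, hs, hcs.symm, h, h', if_true, if_false, pow_succ]
  field_simp

theorem pairWeight_zero_right {m s c : ℕ} (Q : F) {Φ : F} (u : F) (hΦ : Φ ≠ 0) (hs : s ≠ 0)
    (hsm : s ≤ m) (hc : c ≠ 0) (hcs : c ≠ s) :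
    pairWeight m Q Φ u s c 0 = Φ * Q * u * pairWeight m Q Φ u s c s := by
  have h : (if c < s then m + c - s else c - s) =
    (if c < s then m - 1 - (s - c) else c - s - 1) + 1 := by split_ifs <;> omega
  have h' : ¬((c < s ∧ ¬(c < s ∧ s ≤ s)) ∨ (s < s ∧ s ≤ c)) := by omega
  simp only [pairWeight, hc, hs, hcs, h, h', if_true, if_false, pow_succ]
  field_simp

theorem pairWeight_succ_zero_right {m s c : ℕ} (Q : F) {Φ : F} (u : F) (hΦ : Φ ≠ 0) (hs : s ≠ 0)
    (hc : c ≠ 0) (hcs : c ≠ s) :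
    pairWeight m Q Φ u (s + 1) c 0 = Φ * u * pairWeight m Q Φ u s c s := by
  have h : (if c < s + 1 then m + c - (s + 1) else c - (s + 1)) =
    (if c < s then m - 1 - (s - c) else c - s - 1) := by split_ifs <;> omega
  have h' : ¬((c < s ∧ ¬(c < s ∧ s ≤ s)) ∨ (s < s ∧ s ≤ c)) := by omega
  simp only [pairWeight, hc, hs, hcs, h, h', if_true, if_false]
  field_simp

theorem pairWeight_succ_right {m s c : ℕ} (Q Φ u : F) (hs : s ≠ 0) (hc : c ≠ 0) (hcs : c ≠ s) :
    pairWeight m Q Φ u (s + 1) c s = u * pairWeight m Q Φ u s c s := by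
  have h : (c < s ∧ ¬(c < s + 1 ∧ s + 1 ≤ s)) ∨ (s < s + 1 ∧ s + 1 ≤ c) := by omega
  have h' : ¬((c < s ∧ ¬(c < s ∧ s ≤ s)) ∨ (s < s ∧ s ≤ c)) := by omega
  simp only [pairWeight, hc, hs, hcs, if_pos h, if_neg h', if_false]
  ring

theorem pairWeight_succ_left {m s c : ℕ} (Q Φ u : F) (hs : s ≠ 0) (hc : c ≠ 0) (hcs : c ≠ s) :
    pairWeight m Q Φ u s s c = u * pairWeight m Q Φ u (s + 1) s c := by
  have h : (s < c ∧ ¬(s < s ∧ s ≤ c)) ∨ (c < s ∧ s ≤ s) := by omega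
  have h' : ¬((s < c ∧ ¬(s < s + 1 ∧ s + 1 ≤ c)) ∨ (c < s + 1 ∧ s + 1 ≤ s)) := by omega
  simp only [pairWeight, hc, hs, hcs.symm, if_pos h, if_neg h', if_false]
  ring

theorem pairWeight_succ {m s a c : ℕ} (Q Φ u : F) (ha : a ≠ 0) (has : a ≠ s)
    (hc : c ≠ 0) (hcs : c ≠ s) :
    pairWeight m Q Φ u (s + 1) a c = pairWeight m Q Φ u s a c := by
  have h : ((a < c ∧ ¬(a < s + 1 ∧ s + 1 ≤ c)) ∨ (c < s + 1 ∧ s + 1 ≤ a)) =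
    ((a < c ∧ ¬(a < s ∧ s ≤ c)) ∨ (c < s ∧ s ≤ a)) := propext (by omega)
  simp only [pairWeight, ha, hc, if_false, h]

theorem pairWeight_zero_zero (m : ℕ) (Q Φ u : F) (s : ℕ) :
    pairWeight m Q Φ u s 0 0 = Φ * (1 - Q ^ (m + 1) * u) := by
  simp [pairWeight]

theorem pairWeight_zero_self (m : ℕ) (Q Φ u : F) {s : ℕ} (hs : s ≠ 0) :
    pairWeight m Q Φ u s 0 s = (1 - Q) * Q ^ (m - 1) := by
  have : m + s - 1 - s = m - 1 := by omega
  simp [pairWeight, hs, this]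

theorem pairWeight_succ_zero_self (m : ℕ) (Q Φ u : F) {s : ℕ} (hs : s ≠ 0) :
    pairWeight m Q Φ u (s + 1) 0 s = 1 - Q := by
  simp [pairWeight, hs]

theorem pairWeight_self_zero (m : ℕ) (Q Φ u : F) {s : ℕ} (hs : s ≠ 0) :
    pairWeight m Q Φ u s s 0 = (1 - Q) * u := by
  simp [pairWeight, hs]

theorem pairWeight_succ_self_zero (m : ℕ) (Q Φ u : F) {s : ℕ} (hs : s ≠ 0) :
    pairWeight m Q Φ u (s + 1) s 0 = (1 - Q) * u * Q ^ (m - 1) := by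
  have : m + s - (s + 1) = m - 1 := by omega
  simp [pairWeight, hs, this]

theorem pairWeight_self_self (m : ℕ) (Q Φ u : F) (s : ℕ) {a : ℕ} (ha : a ≠ 0) :
    pairWeight m Q Φ u s a a = (Q ^ (m - 1) * u - 1) / Φ := by
  simp [pairWeight, ha]

theorem pairWeight_sub_right {m s : ℕ} (Q : F) {Φ : F} (u : F) (hΦ : Φ ≠ 0) (hs : s ≠ 0)
    (hsm : s ≤ m) {c : ℕ} (hcm : c ≤ m) :
    pairWeight m Q Φ u s c 0 - Φ * Q * u * pairWeight m Q Φ u s c s =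
      if c = 0 then Φ * (1 - Q ^ m * u) else if c = s then u * (1 - Q ^ m * u) else 0 := by
  obtain ⟨n, rfl⟩ : ∃ n, m = n + 1 := ⟨m - 1, by omega⟩
  split_ifs with h h'
  · subst h
    rw [pairWeight_zero_zero, pairWeight_zero_self _ _ _ _ hs, Nat.add_sub_cancel]
    ring
  · subst h'
    rw [pairWeight_self_zero _ _ _ _ hs, pairWeight_self_self _ _ _ _ _ hs, Nat.add_sub_cancel]
    field_simp
    ring
  · rw [pairWeight_zero_right Q u hΦ hs hsm h h', sub_self]

theorem pairWeight_succ_sub_left {m s : ℕ} (Q : F) {Φ : F} (u : F) (hΦ : Φ ≠ 0) (hs : s ≠ 0)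
    (hsm : s ≤ m) {c : ℕ} (hcm : c ≤ m) :
    pairWeight m Q Φ u (s + 1) 0 c - Φ * Q * pairWeight m Q Φ u (s + 1) s c =
      if c = 0 then Φ * (1 - Q ^ m * u) else if c = s then 1 - Q ^ m * u else 0 := by
  obtain ⟨n, rfl⟩ : ∃ n, m = n + 1 := ⟨m - 1, by omega⟩
  split_ifs with h h'
  · subst h
    rw [pairWeight_zero_zero, pairWeight_succ_self_zero _ _ _ _ hs, Nat.add_sub_cancel]
    ring
  · subst h'
    rw [pairWeight_succ_zero_self _ _ _ _ hs, pairWeight_self_self _ _ _ _ _ hs,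
      Nat.add_sub_cancel]
    field_simp
    ring
  · rw [pairWeight_succ_zero_left Q u hΦ hs h h' hcm, sub_self]

theorem pairWeight_exchange_empty {m s : ℕ} (Q : F) {Φ : F} (u : F) (hΦ : Φ ≠ 0) (hs : s ≠ 0)
    (hsm : s ≤ m) {a c : ℕ} (ham : a ≤ m) (hcm : c ≤ m) :
    pairWeight m Q Φ u s a c * (if c = s then u else 1) +
        (if c = 0 then Φ * (1 - Q) * u * pairWeight m Q Φ u s a s else 0) =
      (if a = s then u else 1) * pairWeight m Q Φ u (s + 1) a c +
        if a = 0 then Φ * (1 - Q) * pairWeight m Q Φ u (s + 1) s c else 0 := by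
  obtain ⟨n, rfl⟩ : ∃ n, m = n + 1 := ⟨m - 1, by omega⟩
  rcases eq_or_ne a 0 with rfl | ha
  · rcases eq_or_ne c 0 with rfl | hc
    · simp only [hs.symm, if_true, if_false, pairWeight_zero_zero,
        pairWeight_zero_self _ _ _ _ hs, pairWeight_succ_self_zero _ _ _ _ hs]
      ring
    rcases eq_or_ne c s with rfl | hcs
    · simp only [hc, hs.symm, if_true, if_false, pairWeight_zero_self _ _ _ _ hs,
        pairWeight_succ_zero_self _ _ _ _ hs, pairWeight_self_self _ _ _ _ _ hs]
      field_simp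
      ring
    · simp only [hc, hcs, hs.symm, if_true, if_false,
        pairWeight_zero_left Q u hΦ hs hc hcs,
        pairWeight_succ_zero_left Q u hΦ hs hc hcs hcm]
      ring
  rcases eq_or_ne a s with rfl | has
  · rcases eq_or_ne c 0 with rfl | hc
    · simp only [hs, hs.symm, if_true, if_false, pairWeight_self_zero _ _ _ _ hs,
        pairWeight_succ_self_zero _ _ _ _ hs, pairWeight_self_self _ _ _ _ _ hs]
      field_simp
      ring
    rcases eq_or_ne c a with rfl | hcs
    · simp only [hc, if_true, if_false, pairWeight_self_self _ _ _ _ _ hs]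
      ring
    · simp only [hc, hs, hcs, if_true, if_false, pairWeight_succ_left Q Φ u hs hc hcs]
      ring
  rcases eq_or_ne c 0 with rfl | hc
  · simp only [ha, has, hs.symm, if_true, if_false, pairWeight_zero_right Q u hΦ hs hsm ha has,
      pairWeight_succ_zero_right Q u hΦ hs ha has]
    ring
  rcases eq_or_ne c s with rfl | hcs
  · simp only [ha, hc, has, if_true, if_false, pairWeight_succ_right Q Φ u hs ha has]
    ring
  · simp only [ha, hc, has, hcs, if_false, pairWeight_succ Q Φ u ha has hc hcs]
    ring

theorem pairWeight_exchange_occupied {m s : ℕ} (Q : F) {Φ : F} (u : F) (hΦ : Φ ≠ 0) (hs : s ≠ 0)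
    (hsm : s ≤ m) {a c : ℕ} (ham : a ≤ m) (hcm : c ≤ m) :
    pairWeight m Q Φ u s a c *
          (if c = 0 then Φ ^ 2 else if c = s then Φ ^ 2 * Q ^ 2 * u else Φ ^ 2 * Q) +
        (if c = s then Φ * (1 - Q) * pairWeight m Q Φ u s a 0 else 0) =
      (if a = 0 then Φ ^ 2 else if a = s then Φ ^ 2 * Q ^ 2 * u else Φ ^ 2 * Q) *
          pairWeight m Q Φ u (s + 1) a c +
        if a = s then Φ * (1 - Q) * u * pairWeight m Q Φ u (s + 1) 0 c else 0 := by
  obtain ⟨n, rfl⟩ : ∃ n, m = n + 1 := ⟨m - 1, by omega⟩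
  rcases eq_or_ne a 0 with rfl | ha
  · rcases eq_or_ne c 0 with rfl | hc
    · simp only [hs.symm, if_true, if_false, pairWeight_zero_zero]
      ring
    rcases eq_or_ne c s with rfl | hcs
    · simp only [hc, hs.symm, if_true, if_false, pairWeight_zero_self _ _ _ _ hs,
        pairWeight_succ_zero_self _ _ _ _ hs, pairWeight_zero_zero]
      simp only [Nat.add_sub_cancel]
      ring
    · simp only [hc, hcs, hs.symm, if_true, if_false,
        pairWeight_zero_left Q u hΦ hs hc hcs,
        pairWeight_succ_zero_left Q u hΦ hs hc hcs hcm]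
      ring
  rcases eq_or_ne a s with rfl | has
  · rcases eq_or_ne c 0 with rfl | hc
    · simp only [hs, hs.symm, if_true, if_false, pairWeight_self_zero _ _ _ _ hs,
        pairWeight_succ_self_zero _ _ _ _ hs, pairWeight_zero_zero]
      simp only [Nat.add_sub_cancel]
      ring
    rcases eq_or_ne c a with rfl | hcs
    · simp only [hc, if_true, if_false, pairWeight_self_self _ _ _ _ _ hs,
        pairWeight_self_zero _ _ _ _ hs, pairWeight_succ_zero_self _ _ _ _ hs]
      ring
    · simp only [hc, hs, hcs, if_true, if_false, pairWeight_succ_left Q Φ u hs hc hcs,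
        pairWeight_succ_zero_left Q u hΦ hs hc hcs hcm]
      ring
  rcases eq_or_ne c 0 with rfl | hc
  · simp only [ha, has, hs.symm, if_true, if_false, pairWeight_zero_right Q u hΦ hs hsm ha has,
      pairWeight_succ_zero_right Q u hΦ hs ha has]
    ring
  rcases eq_or_ne c s with rfl | hcs
  · simp only [ha, hc, has, if_true, if_false, pairWeight_succ_right Q Φ u hs ha has,
      pairWeight_zero_right Q u hΦ hs hsm ha has]
    ring
  · simp only [ha, hc, has, hcs, if_false, pairWeight_succ Q Φ u ha has hc hcs]
    ring

end Crossing

section ColumnAlgebra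

open Matrix
open scoped Kronecker

variable {ι F : Type*} [Fintype ι] [DecidableEq ι] [CommRing F]

/-- An entry of an ordered product of matrices is a sum over paths. -/
theorem list_prod_ofFn_apply {n : ℕ} (A : Fin n → Matrix ι ι F) (a c : ι) :
    (List.ofFn A).prod a c = ∑ h : Fin (n + 1) → ι,
      if h 0 = a ∧ h (Fin.last n) = c then ∏ p, A p (h p.castSucc) (h p.succ) else 0 := by
  induction n generalizing a with
  | zero =>
    rw [← (Equiv.funUnique (Fin 1) ι).symm.sum_comp]
    simp [Matrix.one_apply, Equiv.funUnique, ite_and]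
  | succ n ih =>
    rw [List.ofFn_succ, List.prod_cons, Matrix.mul_apply, ← (Fin.consEquiv fun _ => ι).sum_comp,
      Fintype.sum_prod_type, Finset.sum_comm]
    simp only [ih, Finset.mul_sum]
    rw [Finset.sum_comm]
    refine Finset.sum_congr rfl fun h _ => ?_
    simp [Fin.consEquiv, Fin.prod_univ_succ, ite_and, -Fin.succ_last]

theorem sum_list_prod_ofFn {R α : Type*} [Semiring R] [Fintype α] {n : ℕ}
    (f : Fin n → α → R) :
    ∑ e : Fin n → α, (List.ofFn fun p => f p (e p)).prod =
      (List.ofFn fun p => ∑ x, f p x).prod := by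
  induction n with
  | zero => simp
  | succ n ih =>
    rw [← (Fin.consEquiv fun _ => α).sum_comp, Fintype.sum_prod_type]
    simp [Fin.consEquiv, List.ofFn_succ, ← Finset.mul_sum, ih, ← Finset.sum_mul]

theorem list_prod_ofFn_kronecker {n : ℕ} (A B : Fin n → Matrix ι ι F) :
    (List.ofFn A).prod ⊗ₖ (List.ofFn B).prod = (List.ofFn fun p => A p ⊗ₖ B p).prod := by
  induction n with
  | zero => simp
  | succ n ih => simp [List.ofFn_succ, Matrix.mul_kronecker_mul, ih]

/-- An intertwiner that passes through every factor passes through the ordered product. -/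
theorem intertwine_list_prod {R : Type*} [Monoid R] {n : ℕ} (S : ℕ → R) (A B : Fin n → R)
    (h : ∀ p : Fin n, S p * A p = B p * S (p + 1)) :
    S 0 * (List.ofFn A).prod = (List.ofFn B).prod * S n := by
  induction n with
  | zero => simp
  | succ n ih =>
    have h1 := ih (fun p => A p.castSucc) (fun p => B p.castSucc) fun p => h p.castSucc
    have h2 := h (Fin.last n)
    simp only [Fin.val_last] at h2
    simp only [List.ofFn_succ', List.prod_concat]
    rw [← mul_assoc, h1, mul_assoc, h2, mul_assoc]

/-- Reversing a product of operators acting on a vector `e`, when `A t` acts on `e` as a multiple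
of `B t` and the `A`s commute with the `B`s. -/
theorem list_prod_mulVec_reverse {n : ℕ} (A B : Fin n → Matrix ι ι F) (k : Fin n → F) (e : ι → F)
    (he : ∀ t, A t *ᵥ e = k t • (B t *ᵥ e)) (hc : ∀ s t, s ≠ t → Commute (A s) (B t)) :
    (List.ofFn A).prod *ᵥ e = (∏ t, k t) • ((List.ofFn fun t => B t.rev).prod *ᵥ e) := by
  induction n with
  | zero => simp
  | succ n ih =>
    have h1 := ih (fun t => A t.castSucc) (fun t => B t.castSucc) (fun t => k t.castSucc)
      (fun t => he _) (fun s t hst => hc _ _ (by simpa using hst))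
    have h2 : Commute (List.ofFn fun t : Fin n => A t.castSucc).prod (B (Fin.last n)) := by
      refine Commute.list_prod_left _ _ fun x hx => ?_
      obtain ⟨t, rfl⟩ := (List.mem_ofFn' _ _).1 hx
      exact hc _ _ (Fin.castSucc_lt_last t).ne
    rw [List.ofFn_succ', List.prod_concat, ← Matrix.mulVec_mulVec, he, Matrix.mulVec_smul,
      Matrix.mulVec_mulVec, h2.eq, ← Matrix.mulVec_mulVec, h1, Matrix.mulVec_smul, smul_smul,
      Matrix.mulVec_mulVec, Fin.prod_univ_castSucc, List.ofFn_succ, List.prod_cons]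
    simp [Fin.rev_succ, mul_comm]

/-- The matrix of a right-moving vertex with top spin `b` and bottom spin `d`, acting on the
horizontal spins; `o` is the unoccupied spin and `j` the column color. -/
def colR (q Φ z : F) (X : ι → ι → F) (o j b d : ι) : Matrix ι ι F :=
  if b = o ∧ d = o then diagonal fun a => if a = j then z else 1
  else if b = j ∧ d = j then
    diagonal fun a => if a = o then Φ else if a = j then -(Φ * q ^ 2 * z) else Φ * X a j
  else if b = o ∧ d = j then single j o (Φ * (1 - q ^ 2) * z)
  else if b = j ∧ d = o then single o j 1
  else 0

/-- The matrix of a left-moving vertex with top spin `b`, bottom spin `d` and inverse row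
parameter `y`, acting on the horizontal spins. -/
def colL (q Φ y : F) (X : ι → ι → F) (o j b d : ι) : Matrix ι ι F :=
  if b = o ∧ d = o then diagonal fun a => if a = j then y else 1
  else if b = j ∧ d = j then
    diagonal fun a => if a = o then Φ else if a = j then -(Φ * q ^ 2 * y) else Φ * X j a
  else if b = o ∧ d = j then single o j (Φ * (1 - q ^ 2))
  else if b = j ∧ d = o then single j o y
  else 0

/-- The intertwiner that is diagonal with entries `d a b` on pairs of distinct spins and equal to
`P` on pairs of equal spins. -/
def crossing (d P : ι → ι → F) : Matrix (ι × ι) (ι × ι) F :=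
  Matrix.of fun x y => if x.1 = x.2 then (if y.1 = y.2 then P x.1 y.1 else 0)
    else if x = y then d x.1 x.2 else 0

theorem crossing_mul_apply (d P : ι → ι → F) (M : Matrix (ι × ι) (ι × ι) F) (a b : ι) (y : ι × ι) :
    (crossing d P * M) (a, b) y =
      if a = b then ∑ c, P a c * M (c, c) y else d a b * M (a, b) y := by
  rw [Matrix.mul_apply]
  split_ifs with h
  · simp [crossing, h, Fintype.sum_prod_type]
  · simp [crossing, h]

theorem mul_crossing_apply (d P : ι → ι → F) (M : Matrix (ι × ι) (ι × ι) F) (a b : ι) (y : ι × ι) :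
    (M * crossing d P) y (a, b) =
      if a = b then ∑ c, M y (c, c) * P c a else M y (a, b) * d a b := by
  rw [Matrix.mul_apply]
  split_ifs with h
  · rw [Fintype.sum_prod_type]
    refine Finset.sum_congr rfl fun c _ => ?_
    rw [Finset.sum_eq_single c]
    · simp [crossing, h]
    · intro x _ hx
      simp only [crossing, Matrix.of_apply, hx.symm, Prod.mk.injEq, if_false]
      rw [if_neg (by rintro ⟨rfl, rfl⟩; exact hx h.symm), mul_zero]
    · simp
  · rw [Finset.sum_eq_single (a, b)]
    · simp [crossing, h]
    · intro x _ hx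
      simp [crossing, h, hx]
    · simp

/-- The Yang–Baxter equation exchanging a right-moving and a left-moving row in a column of
color `j`. -/
theorem yang_baxter (q Φ z y δ : F) (X d P P' : ι → ι → F) {o j : ι} (hj : j ≠ o) (t b : ι)
    (hX : ∀ a, a ≠ o → a ≠ j → X a j * X j a = q ^ 2)
    (hd₀ : ∀ a, a ≠ o → d a o = δ) (hd₀' : ∀ a, a ≠ o → d o a = δ)
    (hd : ∀ a, a ≠ o → a ≠ j → Φ * X a j * d a j = δ)
    (hd' : ∀ a, a ≠ o → a ≠ j → Φ * X j a * d j a = δ)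
    (h₁ : ∀ c, P c o - Φ * q ^ 2 * (z * y) * P c j =
      if c = o then Φ * δ else if c = j then z * y * δ else 0)
    (h₂ : ∀ c, P' o c - Φ * q ^ 2 * P' j c =
      if c = o then Φ * δ else if c = j then δ else 0)
    (h₃ : ∀ a c, P a c * (if c = j then z * y else 1) +
        (if c = o then Φ * (1 - q ^ 2) * (z * y) * P a j else 0) =
      (if a = j then z * y else 1) * P' a c + if a = o then Φ * (1 - q ^ 2) * P' j c else 0)
    (h₄ : ∀ a c, P a c *
          (if c = o then Φ ^ 2 else if c = j then Φ ^ 2 * q ^ 4 * (z * y) else Φ ^ 2 * q ^ 2) +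
        (if c = j then Φ * (1 - q ^ 2) * P a o else 0) =
      (if a = o then Φ ^ 2 else if a = j then Φ ^ 2 * q ^ 4 * (z * y) else Φ ^ 2 * q ^ 2) *
          P' a c + if a = j then Φ * (1 - q ^ 2) * (z * y) * P' o c else 0) :
    crossing d P * (∑ e, colR q Φ z X o j t e ⊗ₖ colL q Φ y X o j e b) =
      (∑ e, colR q Φ z X o j e b ⊗ₖ colL q Φ y X o j t e) * crossing d P' := by
  have hsum : ∀ f : ι → Matrix (ι × ι) (ι × ι) F, (∀ e, e ≠ o → e ≠ j → f e = 0) →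
      ∑ e, f e = f o + f j := by
    intro f hf
    refine Fintype.sum_eq_add o j hj.symm fun e he => hf e he.1 he.2
  rw [hsum _ fun e h h' => by simp [colR, h, h'], hsum _ fun e h h' => by simp [colR, h, h']]
  by_cases ht : t = o ∨ t = j
  swap
  · obtain ⟨h, h'⟩ := not_or.1 ht
    simp [colR, colL, h, h']
  by_cases hb : b = o ∨ b = j
  swap
  · obtain ⟨h, h'⟩ := not_or.1 hb
    simp [colR, colL, h, h']
  ext ⟨a, a'⟩ ⟨c, c'⟩
  rw [crossing_mul_apply, mul_crossing_apply]
  rcases ht with ht | ht <;> rcases hb with hb | hb <;> simp only [ht, hb] <;> clear ht hb hsum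
  all_goals
    by_cases haa : a = a' <;> by_cases hcc : c = c'
    all_goals
      simp only [haa, hcc, if_true, if_false]
      simp [colR, colL, hj, hj.symm, Matrix.add_apply, kroneckerMap_apply, diagonal_apply,
        single_apply, mul_add, add_mul, Finset.sum_add_distrib, ite_and, Finset.sum_ite_irrel]
      try grind
  · have := h₃ a' c'
    clear h₁ h₂ h₃ h₄ hX hd hd' hd₀ hd₀'
    grind
  · have := h₁ a'
    have := hd₀' j hj
    clear h₁ h₂ h₃ h₄ hX hd hd' hd₀ hd₀'
    grind
  · have := h₂ c'
    have := hd₀ j hj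
    clear h₁ h₂ h₃ h₄ hX hd hd' hd₀ hd₀'
    grind
  · have := h₁ a'
    have := hd₀ j hj
    clear h₁ h₂ h₃ h₄ hX hd hd' hd₀ hd₀'
    grind
  · have := h₂ c'
    have := hd₀' j hj
    clear h₁ h₂ h₃ h₄ hX hd hd' hd₀ hd₀'
    grind
  · have key := h₄ a' c'
    have hXa := hX a'
    have hXc := hX c'
    clear h₁ h₂ h₃ h₄ hX hd hd' hd₀ hd₀'
    rcases eq_or_ne a' o with ha | ha <;> rcases eq_or_ne a' j with ha' | ha' <;>
      rcases eq_or_ne c' o with hc | hc <;> rcases eq_or_ne c' j with hc' | hc' <;>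
      first
      | exact absurd (ha'.symm.trans ha) hj
      | exact absurd (hc'.symm.trans hc) hj
      | (simp only [ha, ha', hc, hc', ne_eq, not_false_eq_true, forall_const, if_true, if_false,
          hj, hj.symm] at key hXa hXc ⊢
         grind)
end ColumnAlgebra

section RowTransfer

open Matrix
open scoped Kronecker

variable {ι F : Type*} [Fintype ι] [DecidableEq ι] [Field F]

/-- The transfer matrix of a row with left boundary spin `a` and right boundary spin `c`, whose
`p`-th vertex has matrix `W p b d` when its top spin is `b` and its bottom spin is `d`. -/
def rowTransfer {n : ℕ} (W : Fin n → ι → ι → Matrix ι ι F) (a c : ι) :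
    Matrix (Fin n → ι) (Fin n → ι) F :=
  Matrix.of fun b d => (List.ofFn fun p => W p (b p) (d p)).prod a c

theorem rowTransfer_mul_rowTransfer {n : ℕ} (A B : Fin n → ι → ι → Matrix ι ι F) (a c a' c' : ι)
    (t b : Fin n → ι) :
    (rowTransfer A a c * rowTransfer B a' c') t b =
      (List.ofFn fun p => ∑ e, A p (t p) e ⊗ₖ B p e (b p)).prod (a, a') (c, c') := by
  rw [← sum_list_prod_ofFn fun p e => A p (t p) e ⊗ₖ B p e (b p), Matrix.mul_apply,
    Matrix.sum_apply]
  simp [← list_prod_ofFn_kronecker, rowTransfer]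

theorem rowTransfer_mul_rowTransfer' {n : ℕ} (A B : Fin n → ι → ι → Matrix ι ι F)
    (a c a' c' : ι) (t b : Fin n → ι) :
    (rowTransfer B a' c' * rowTransfer A a c) t b =
      (List.ofFn fun p => ∑ e, A p e (b p) ⊗ₖ B p (t p) e).prod (a, a') (c, c') := by
  rw [← sum_list_prod_ofFn fun p e => A p e (b p) ⊗ₖ B p (t p) e, Matrix.mul_apply,
    Matrix.sum_apply]
  simp [← list_prod_ofFn_kronecker, rowTransfer, mul_comm]

/-- The train argument: rows whose vertices satisfy a Yang–Baxter equation have commuting transfer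
matrices. -/
theorem rowTransfer_commute {n : ℕ} (A B : Fin n → ι → ι → Matrix ι ι F)
    (d : ι → ι → F) (P : ℕ → ι → ι → F) {o σ σ' : ι} (hσ : σ ≠ o) (hσ' : σ' ≠ o)
    (hd : d o σ' = d σ o) (hd₀ : d σ o ≠ 0)
    (h : ∀ (p : Fin n) (t b : ι), crossing d (P p) * (∑ e, A p t e ⊗ₖ B p e b) =
      (∑ e, A p e b ⊗ₖ B p t e) * crossing d (P (p + 1))) :
    Commute (rowTransfer A o σ) (rowTransfer B σ' o) := by
  ext t b
  rw [rowTransfer_mul_rowTransfer, rowTransfer_mul_rowTransfer']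
  have key := congrFun (congrFun (intertwine_list_prod (fun k => crossing d (P k))
    (fun p => ∑ e, A p (t p) e ⊗ₖ B p e (b p)) (fun p => ∑ e, A p e (b p) ⊗ₖ B p (t p) e)
    fun p => h p (t p) (b p)) (o, σ')) (σ, o)
  rw [crossing_mul_apply, mul_crossing_apply, if_neg hσ'.symm, if_neg hσ, hd,
    mul_comm _ (d σ o)] at key
  exact mul_left_cancel₀ hd₀ key

/-- Duality for a single row with no occupied edge below it. -/
theorem single_row_duality {n : ℕ} (q Φ : F) {z : F} (hz : z ≠ 0) (X : ι → ι → F) {o σ : ι}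
    (hσ : σ ≠ o) (col v : Fin n → ι) (hcol : ∀ p, col p ≠ o) :
    (List.ofFn fun p => colR q Φ z X o (col p) (v p) o).prod o σ =
      (∏ p, if col p = σ then z else 1) *
        (List.ofFn fun p => colL q Φ z⁻¹ X o (col p) (v p) o).prod σ o := by
  suffices H : (List.ofFn fun p => colR q Φ z X o (col p) (v p) o).prod o σ =
      (∏ p, if col p = σ then z else 1) *
        (List.ofFn fun p => colL q Φ z⁻¹ X o (col p) (v p) o).prod σ o ∧
      (List.ofFn fun p => colR q Φ z X o (col p) (v p) o).prod o o =
      (∏ p, if col p = σ then z else 1) *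
        (List.ofFn fun p => colL q Φ z⁻¹ X o (col p) (v p) o).prod σ σ ∧
      ∀ x, x ≠ o → x ≠ σ →
        (List.ofFn fun p => colL q Φ z⁻¹ X o (col p) (v p) o).prod σ x = 0 from H.1
  induction n with
  | zero => simpa [Matrix.one_apply, hσ, hσ.symm] using fun x _ h h' => h h'.symm
  | succ n ih =>
    obtain ⟨h₁, h₂, h₃⟩ := ih (fun p => col p.castSucc) (fun p => v p.castSucc)
      fun p => hcol p.castSucc
    simp only [List.ofFn_succ', List.prod_concat, Fin.prod_univ_castSucc]
    set A := (List.ofFn fun p : Fin n => colR q Φ z X o (col p.castSucc) (v p.castSucc) o).prod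
    set B := (List.ofFn fun p : Fin n => colL q Φ z⁻¹ X o (col p.castSucc) (v p.castSucc) o).prod
    set k := ∏ p : Fin n, if col p.castSucc = σ then z else 1
    have hj := hcol (Fin.last n)
    set j := col (Fin.last n)
    set w := v (Fin.last n)
    by_cases hw : w = o
    · have hR : colR q Φ z X o j w o = diagonal fun a => if a = j then z else 1 := by
        simp [colR, hw]
      have hL : colL q Φ z⁻¹ X o j w o = diagonal fun a => if a = j then z⁻¹ else 1 := by
        simp [colL, hw]
      rw [hR, hL]
      simp only [Matrix.mul_diagonal, hj.symm, if_false]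
      refine ⟨?_, ?_, fun x hx hx' => by rw [h₃ x hx hx', zero_mul]⟩
      · rw [h₁]
        by_cases h : σ = j
        · simp [h]
          ring
        · simp [h, eq_comm (a := j)]
      · rw [h₂]
        by_cases h : σ = j
        · simp [h]
          field_simp
        · simp [h, Ne.symm h]
    · by_cases hw' : w = j
      · have hR : colR q Φ z X o j w o = single o j 1 := by
          simp [colR, hw', hj, hj.symm]
        have hL : colL q Φ z⁻¹ X o j w o = single j o z⁻¹ := by
          simp [colL, hw', hj, hj.symm]
        rw [hR, hL]
        simp only [Matrix.mul_apply, single_apply, mul_ite, mul_zero, ite_and]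
        simp only [Finset.sum_ite_eq, Finset.mem_univ, if_true, hj, if_false, mul_one]
        refine ⟨?_, ?_, fun x hx hx' => ?_⟩
        · by_cases h : j = σ
          · simp [h, h₂]
            field_simp
          · simp [h, h₃ j hj h]
        · simp [hσ.symm]
        · simp [hx.symm]
      · have hR : colR q Φ z X o j w o = 0 := by simp [colR, hw, hw']
        have hL : colL q Φ z⁻¹ X o j w o = 0 := by simp [colL, hw, hw']
        simp [hR, hL]

end RowTransfer

section LatticeModel

open Matrix

theorem list_prod_ofFn_rowTransfer {ι F : Type*} [Fintype ι] [DecidableEq ι] [Field F] {r n : ℕ}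
    (W : Fin r → Fin n → ι → ι → Matrix ι ι F) (x y : Fin r → ι) (v w : Fin n → ι) :
    (List.ofFn fun t => rowTransfer (W t) (x t) (y t)).prod v w =
      ∑ s : (Fin r → Fin (n + 1) → ι) × (Fin (r + 1) → Fin n → ι),
        if (s.2 0 = v ∧ s.2 (Fin.last r) = w) ∧ ∀ t, s.1 t 0 = x t ∧ s.1 t (Fin.last n) = y t then
          ∏ t, ∏ p, W t p (s.2 t.castSucc p) (s.2 t.succ p) (s.1 t p.castSucc) (s.1 t p.succ)
        else 0 := by
  rw [Fintype.sum_prod_type_right, list_prod_ofFn_apply]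
  refine Finset.sum_congr rfl fun h _ => ?_
  by_cases hh : h 0 = v ∧ h (Fin.last r) = w
  · simp only [hh, if_true, true_and, and_self]
    simp only [rowTransfer, of_apply, list_prod_ofFn_apply]
    rw [Finset.prod_univ_sum, Fintype.piFinset_univ]
    refine Finset.sum_congr rfl fun g _ => ?_
    rw [Finset.prod_ite_zero]
    simp
  · simp [hh]

/-- The factors `𝔛_{i,j}`, indexed by spins. -/
noncomputable def spinX (m r : ℕ) (a b : Fin (m + 1)) : K m r := Xfrak m r a b

theorem wtVertex_R (m r : ℕ) (z : K m r) {j : Fin (m + 1)} (hj : j ≠ 0) (a b c d : Fin (m + 1)) :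
    wtVertex m r .R z j a b c d = colR (qv m r) (Φv m r) z (spinX m r) 0 j b d a c := by
  have hX : Xfrak m r j j = -(qv m r) ^ 2 := by simp [Xfrak]
  have h0 : ∀ x : Fin (m + 1), (x : ℕ) = 0 ↔ x = 0 := fun x => Fin.val_eq_zero_iff
  simp only [wtVertex, colR, ← Fin.ext_iff, spinX, h0, ne_eq]
  by_cases hb : b = 0 ∧ d = 0
  · grind [diagonal_apply]
  by_cases hb' : b = j ∧ d = j
  · grind [diagonal_apply]
  by_cases hb' : b = 0 ∧ d = j
  · grind
  by_cases hb' : b = j ∧ d = 0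
  · grind
  grind [Matrix.zero_apply]

theorem wtVertex_L (m r : ℕ) (z : K m r) {j : Fin (m + 1)} (hj : j ≠ 0) (a b c d : Fin (m + 1)) :
    wtVertex m r .L z j a b c d = colL (qv m r) (Φv m r) z⁻¹ (spinX m r) 0 j b d a c := by
  have hX : Xfrak m r j j = -(qv m r) ^ 2 := by simp [Xfrak]
  have h0 : ∀ x : Fin (m + 1), (x : ℕ) = 0 ↔ x = 0 := fun x => Fin.val_eq_zero_iff
  simp only [wtVertex, colL, ← Fin.ext_iff, spinX, h0, ne_eq]
  by_cases hb : b = 0 ∧ d = 0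
  · grind [diagonal_apply]
  by_cases hb' : b = j ∧ d = j
  · grind [diagonal_apply]
  by_cases hb' : b = 0 ∧ d = j
  · grind
  by_cases hb' : b = j ∧ d = 0
  · grind
  grind [Matrix.zero_apply]

theorem vr_ne_zero (m r : ℕ) (v : Vars m r) : vr m r v ≠ 0 := by
  simp [vr, MvPolynomial.X_ne_zero]

theorem spinX_ne_zero {m r : ℕ} (a b : Fin (m + 1)) : spinX m r a b ≠ 0 := by
  have := vr_ne_zero m r
  unfold spinX Xfrak
  split_ifs <;> simp [qv, Xv, this]

theorem spinX_mul_spinX {m r : ℕ} {a b : Fin (m + 1)} (ha : a ≠ 0) (hb : b ≠ 0) (hab : a ≠ b) :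
    spinX m r a b * spinX m r b a = qv m r ^ 2 := by
  have h : ∀ i, Xv m r i ≠ 0 := fun i => vr_ne_zero m r _
  have ha' : 1 ≤ (a : ℕ) := Nat.pos_of_ne_zero fun h => ha (Fin.ext h)
  have hb' : 1 ≤ (b : ℕ) := Nat.pos_of_ne_zero fun h => hb (Fin.ext h)
  have ham : (a : ℕ) ≤ m := by lia
  have hbm : (b : ℕ) ≤ m := by lia
  unfold spinX Xfrak
  rcases lt_or_gt_of_ne (fun h => hab (Fin.ext h) : (a : ℕ) ≠ b) with hlt | hlt
  · simp only [ha', hb', ham, hbm, hlt, hlt.not_gt, and_true, and_false, dif_pos, dif_neg,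
      not_false_eq_true]
    rw [mul_left_comm, mul_inv_cancel₀ (h _), mul_one]
  · simp only [ha', hb', ham, hbm, hlt, hlt.not_gt, and_true, and_false, dif_pos, dif_neg,
      not_false_eq_true]
    rw [mul_assoc, inv_mul_cancel₀ (h _), mul_one]

theorem one_sub_ne_zero {m r : ℕ} (hm : m ≠ 0) (s t : Fin r) :
    1 - (qv m r ^ 2) ^ m * (zv m r s * (zv m r t)⁻¹) ≠ 0 := by
  intro h
  have ht : zv m r t ≠ 0 := vr_ne_zero m r _
  have h' : zv m r t = (qv m r ^ 2) ^ m * zv m r s := by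
    field_simp at h
    linear_combination h
  simp only [zv, qv, vr, ← map_pow, ← map_mul] at h'
  have key := congrArg (MvPolynomial.eval fun v : Vars m r =>
    Sum.elim (fun _ => (0 : ℚ)) (fun _ => 1) v) (IsFractionRing.injective _ (K m r) h')
  simp [hm] at key

theorem transfer_commute {m r n : ℕ} (s t : Fin r) (hm : 0 < m) {σ τ : Fin (m + 1)}
    (hσ : σ ≠ 0) (hτ : τ ≠ 0) (col : Fin n → Fin (m + 1))
    (hcol : ∀ p : Fin n, (col p : ℕ) = p % m + 1) :
    Commute
      (rowTransfer (fun p => colR (qv m r) (Φv m r) (zv m r s) (spinX m r) 0 (col p)) 0 σ)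
      (rowTransfer (fun p => colL (qv m r) (Φv m r) (zv m r t)⁻¹ (spinX m r) 0 (col p)) τ 0) := by
  set q := qv m r
  set Φ := Φv m r
  set z := zv m r s
  set y := (zv m r t)⁻¹
  set X := spinX m r
  set δ : K m r := 1 - (q ^ 2) ^ m * (z * y) with hδ
  have hδ0 : δ ≠ 0 := one_sub_ne_zero hm.ne' s t
  have hΦ : Φ ≠ 0 := vr_ne_zero m r _
  have hX0 : ∀ a b, X a b ≠ 0 := spinX_ne_zero
  refine rowTransfer_commute _ _
    (fun a b => if a = 0 ∨ b = 0 then δ else δ / (Φ * X a b))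
    (fun p a c => pairWeight m (q ^ 2) Φ (z * y) (p % m + 1) a c) hσ hτ (by simp) (by simp [hδ0])
    fun p v w => ?_
  have hj : col p ≠ 0 := fun h => by simpa [h] using hcol p
  have hP : (fun a c : Fin (m + 1) => pairWeight m (q ^ 2) Φ (z * y) ((p + 1) % m + 1) a c) =
      fun a c : Fin (m + 1) => pairWeight m (q ^ 2) Φ (z * y) (col p + 1) a c := by
    ext a c
    have hlt := Nat.mod_lt (p : ℕ) hm
    rw [hcol]
    rw [← Nat.mod_add_mod]
    by_cases h : (p : ℕ) % m + 1 = m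
    · rw [h, Nat.mod_self, pairWeight_wrap _ _ _ (by lia) (by lia)]
    · rw [Nat.mod_eq_of_lt (by lia : (p : ℕ) % m + 1 < m)]
  rw [hP]
  have hm' : (col p : ℕ) ≤ m := by lia
  have hj' : (col p : ℕ) ≠ 0 := fun h => hj (Fin.ext h)
  have hv : ∀ x : Fin (m + 1), (x : ℕ) = 0 ↔ x = 0 := fun x => Fin.val_eq_zero_iff
  simp only [← hcol]
  refine yang_baxter q Φ z y δ X _ _ _ hj v w (fun a ha ha' => spinX_mul_spinX ha hj ha')
    (by simp) (by simp) ?_ ?_ ?_ ?_ ?_ ?_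
  · intro a ha ha'
    have := hX0 a (col p)
    simp only [ha, hj, or_self, if_false]
    field_simp
  · intro a ha ha'
    have := hX0 (col p) a
    simp only [ha, hj, or_self, if_false]
    field_simp
  · intro c
    have := pairWeight_sub_right (q ^ 2) (z * y) hΦ hj' hm' (c := c) (by lia)
    simpa [hv, ← Fin.ext_iff] using this
  · intro c
    have := pairWeight_succ_sub_left (q ^ 2) (z * y) hΦ hj' hm' (c := c) (by lia)
    simpa [hv, ← Fin.ext_iff] using this
  · intro a c
    have := pairWeight_exchange_empty (q ^ 2) (z * y) hΦ hj' hm' (a := a) (c := c) (by lia) (by lia)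
    simpa [hv, ← Fin.ext_iff] using this
  · intro a c
    have := pairWeight_exchange_occupied (q ^ 2) (z * y) hΦ hj' hm' (a := a) (c := c) (by lia) (by lia)
    simpa [hv, ← Fin.ext_iff, ← pow_mul] using this

theorem colColor_eq {m N : ℕ} (hm : 0 < m) (p : Fin (N * m)) :
    colColor m (N * m) p = p % m + 1 := by
  obtain ⟨p, hp⟩ := p
  have hlt := Nat.mod_lt p hm
  obtain ⟨k, hk⟩ := Nat.exists_eq_add_of_lt (Nat.div_lt_of_lt_mul (mul_comm N m ▸ hp))
  have hdiv := Nat.div_add_mod p m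
  simp only [colColor, colNum]
  generalize p % m = a at *
  generalize p / m = b at *
  have h : N * m - 1 - p = m * k + (m - 1 - a) := by
    have : N * m = m * b + m * k + m := by rw [hk]; ring
    lia
  have ha : m - 1 - a < m := by lia
  rw [h, Nat.mul_add_mod, Nat.mod_eq_of_lt ha]
  lia

theorem prod_ite_mod_eq {F : Type*} [CommMonoid F] {m N : ℕ} (z : F) {σ : ℕ} (hσ : 1 ≤ σ)
    (hσm : σ ≤ m) : ∏ p : Fin (N * m), (if (p : ℕ) % m + 1 = σ then z else 1) = z ^ N := by
  rw [← Equiv.prod_comp finProdFinEquiv, Fintype.prod_prod_type]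
  have h : ∀ x : Fin N, ∏ y : Fin m,
      (if (finProdFinEquiv (x, y) : ℕ) % m + 1 = σ then z else 1) = z := by
    intro x
    rw [Fintype.prod_eq_single (⟨σ - 1, by lia⟩ : Fin m)]
    · simp [Nat.mod_eq_of_lt (by lia : σ - 1 < m), Nat.sub_add_cancel hσ]
    · intro y hy
      rw [if_neg]
      simp only [finProdFinEquiv_apply_val, Nat.add_mul_mod_self_left, Nat.mod_eq_of_lt y.2]
      intro h
      exact hy (Fin.ext (by simp; lia))
  simp only [h, Finset.prod_const, Finset.card_univ, Fintype.card_fin]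

theorem Z_eq_list_prod {m r n : ℕ} (ty : RowType) (w : Fin r → K m r) (μ σ : Fin r → ℕ)
    (col top : Fin n → Fin (m + 1)) (τ x y : Fin r → Fin (m + 1))
    (W : Fin r → Fin n → Fin (m + 1) → Fin (m + 1) → Matrix (Fin (m + 1)) (Fin (m + 1)) (K m r))
    (hcol : ∀ p, (col p : ℕ) = colColor m n p)
    (htop : ∀ p, (top p : ℕ) = if ∃ t, μ t = colNum n p then colColor m n p else 0)
    (hτ : ∀ t, (τ t : ℕ) = σ t)
    (hx : ∀ t, x t = if ty = .R then 0 else τ t) (hy : ∀ t, y t = if ty = .R then τ t else 0)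
    (hW : ∀ t p, ∀ a b c d : Fin (m + 1),
      wtVertex m r ty (w t) (col p) a b c d = W t p b d a c) :
    Z m r n (fun _ => ty) w μ σ =
      (List.ofFn fun t => rowTransfer (W t) (x t) (y t)).prod top fun _ => 0 := by
  rw [list_prod_ofFn_rowTransfer, Z]
  refine Finset.sum_congr rfl fun s _ => ?_
  have hbc : bc m r n (fun _ => ty) μ σ s ↔
      (s.2 0 = top ∧ s.2 (Fin.last r) = fun _ => 0) ∧
        ∀ t, s.1 t 0 = x t ∧ s.1 t (Fin.last n) = y t := by
    simp only [bc, ← htop, ← hτ, ← Fin.ext_iff, funext_iff, and_assoc, hx, hy]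
    cases ty <;> simp [and_comm]
  simp only [hbc, wtState, ← hcol, hW]

end LatticeModel

/-- Left-right duality: the partition function of the all-right-moving
system equals `(z₁⋯z_r)^N` times the partition function of the all-left-moving system with
reversed horizontal boundary colors and reversed row parameters. -/
theorem left_right_duality (m r N : ℕ) (hm : 1 ≤ m) (hr : 1 ≤ r) (hN : 1 ≤ N)
    (μ : Fin r → ℕ) (hμdec : ∀ s t : Fin r, s < t → μ t < μ s)
    (hμN : ∀ t : Fin r, μ t < N * m)
    (σ : Fin r → ℕ) (hσ : ∀ t : Fin r, 1 ≤ σ t ∧ σ t ≤ m) :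
    Z m r (N * m) (fun _ => RowType.R) (zv m r) μ σ
      = (∏ t : Fin r, zv m r t) ^ N *
        Z m r (N * m) (fun _ => RowType.L) (fun t => zv m r t.rev) μ (fun t => σ t.rev) := by
  set col : Fin (N * m) → Fin (m + 1) := fun p => ⟨p % m + 1, by
    have := Nat.mod_lt (p : ℕ) hm
    lia⟩
  set top : Fin (N * m) → Fin (m + 1) := fun p =>
    if ∃ t, μ t = colNum (N * m) p then col p else 0
  set τ : Fin r → Fin (m + 1) := fun t => ⟨σ t, Nat.lt_succ_of_le (hσ t).2⟩
  have hτ : ∀ t, τ t ≠ 0 := fun t h => by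
    have := congrArg Fin.val h
    have := (hσ t).1
    simp_all [τ]
  have hcol : ∀ p, (col p : ℕ) = colColor m (N * m) p := fun p => (colColor_eq hm p).symm
  have hcol₀ : ∀ p, col p ≠ 0 := fun p h => by simpa [col] using congrArg Fin.val h
  have htop : ∀ p, (top p : ℕ) =
      if ∃ t, μ t = colNum (N * m) p then colColor m (N * m) p else 0 := fun p => by
    simp only [top, ← hcol]
    split_ifs <;> rfl
  set WR : Fin r → Fin (N * m) → _ := fun t p =>
    colR (qv m r) (Φv m r) (zv m r t) (spinX m r) 0 (col p)
  set WL : Fin r → Fin (N * m) → _ := fun t p =>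
    colL (qv m r) (Φv m r) (zv m r t)⁻¹ (spinX m r) 0 (col p)
  rw [Z_eq_list_prod .R (zv m r) μ σ col top τ (fun _ => 0) τ WR hcol htop (fun _ => rfl)
      (fun _ => rfl) (fun _ => rfl) fun t p a b c d => wtVertex_R m r _ (hcol₀ p) a b c d,
    Z_eq_list_prod .L (fun t => zv m r t.rev) μ (fun t => σ t.rev) col top (fun t => τ t.rev)
      (fun t => τ t.rev) (fun _ => 0) (fun t => WL t.rev) hcol htop (fun _ => rfl)
      (fun _ => rfl) (fun _ => rfl) fun t p a b c d => wtVertex_L m r _ (hcol₀ p) a b c d]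
  have key := list_prod_mulVec_reverse (fun t => rowTransfer (WR t) 0 (τ t))
    (fun t => rowTransfer (WL t) (τ t) 0) (fun t => zv m r t ^ N)
    (Pi.single (fun _ => 0) 1) (fun t => ?_)
    fun s t _ => transfer_commute s t hm (hτ s) (hτ t) col fun _ => rfl
  · have := congrFun key top
    rw [Matrix.mulVec_single_one, Matrix.mulVec_single_one, Finset.prod_pow] at this
    exact this
  · ext v
    rw [Matrix.mulVec_single_one, Matrix.mulVec_single_one]
    simp only [Matrix.col_apply, rowTransfer, Matrix.of_apply, Pi.smul_apply, smul_eq_mul, WR, WL]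
    have hz : zv m r t ≠ 0 := vr_ne_zero m r _
    refine (single_row_duality _ _ hz _ (hτ t) _ v hcol₀).trans ?_
    rw [← prod_ite_mod_eq (N := N) _ (hσ t).1 (hσ t).2]
    simp only [Fin.ext_iff, col, τ]

end Lattice
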